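/- arXiv:quant-ph/0205025 — 3 statements merged into one kernel-verified Lean document; each statement's English description precedes it below -/
import Mathlib

section
/- Let n be an even positive integer and V a real n×n circulant symmetric positive definite matrix with block form V = [[V', V''], [V'', V']] (n/2 × n/2 blocks), and write F = F_{n/2}. Then V' + V''F and V' − V''F are real symmetric positive definite. Let p be a real number, P = I_{n/2} ⊕ (−I_{n/2}), and Q = V^{−p} P V^{p} P, which by the block-structure lemma has block form Q = [[Q', Q''], [Q'', Q']]. Then Q' + Q''F = (V' + V''F)^{−p} (V' − V''F)^{p} and Q' − Q''F = (V' − V''F)^{−p} (V' + V''F)^{p}. -/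
open Matrix

/-- The `m × m` flip matrix `F_m`: with 0-based indices, entry `(i,j)` is `1`
iff `i + j = m - 1`. -/
noncomputable def flipMat (m : ℕ) : Matrix (Fin m) (Fin m) ℝ :=
  Matrix.of fun i j => if (i : ℕ) + (j : ℕ) = m - 1 then 1 else 0

/-- Real matrix power `M ^ p` defined via the continuous functional calculus
(spectral calculus); for a real symmetric positive definite matrix this is the
usual spectral power. -/
noncomputable def mpow {k : ℕ} (M : Matrix (Fin k) (Fin k) ℝ) (p : ℝ) :
    Matrix (Fin k) (Fin k) ℝ :=
  cfc (fun x : ℝ => x ^ p) M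

theorem aux_intertwine {a b : ℕ} (A : Matrix (Fin a) (Fin a) ℝ) (B : Matrix (Fin b) (Fin b) ℝ)
    (W : Matrix (Fin a) (Fin b) ℝ) (hA : A.IsHermitian) (hB : B.IsHermitian)
    (h : A * W = W * B) (f : ℝ → ℝ) : cfc f A * W = W * cfc f B := by
  have hA' : IsSelfAdjoint A := hA
  have hB' : IsSelfAdjoint B := hB
  have fin : (spectrum ℝ A ∪ spectrum ℝ B).Finite :=
    (Matrix.finite_real_spectrum).union (Matrix.finite_real_spectrum)
  let q : Polynomial ℝ := Lagrange.interpolate fin.toFinset id f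
  have hq : ∀ x ∈ spectrum ℝ A ∪ spectrum ℝ B, f x = q.eval x := by
    intro x hx
    exact (Lagrange.eval_interpolate_at_node f (v := id) (Set.injOn_id _)
      (fin.mem_toFinset.2 hx)).symm
  have e1 : cfc f A = Polynomial.aeval A q := by
    rw [← cfc_polynomial (R := ℝ) q A]
    exact cfc_congr fun x hx => hq x (Or.inl hx)
  have e2 : cfc f B = Polynomial.aeval B q := by
    rw [← cfc_polynomial (R := ℝ) q B]
    exact cfc_congr fun x hx => hq x (Or.inr hx)
  rw [e1, e2]
  have hpow : ∀ k : ℕ, A ^ k * W = W * B ^ k := by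
    intro k
    induction k with
    | zero => simp
    | succ k ih => rw [pow_succ, Matrix.mul_assoc, h, ← Matrix.mul_assoc, ih, Matrix.mul_assoc, ← pow_succ]
  simp only [Polynomial.aeval_eq_sum_range, Matrix.sum_mul, Matrix.mul_sum, Matrix.smul_mul,
    Matrix.mul_smul, hpow]

theorem aux_flip {m : ℕ} (i j : Fin m) : flipMat m i j = if i = Fin.rev j then 1 else 0 := by
  have hh : ((i : ℕ) + (j : ℕ) = m - 1) ↔ i = Fin.rev j := by
    rw [Fin.ext_iff, Fin.val_rev]; omega
  simp [flipMat, hh]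

theorem aux_mul_flip {m : ℕ} {α : Type*} (X : Matrix α (Fin m) ℝ) (i : α) (j : Fin m) :
    (X * flipMat m) i j = X i (Fin.rev j) := by
  simp [Matrix.mul_apply, aux_flip]

theorem aux_flip_mul {m : ℕ} {α : Type*} (X : Matrix (Fin m) α ℝ) (i : Fin m) (j : α) :
    (flipMat m * X) i j = X (Fin.rev i) j := by
  have : ∀ k : Fin m, i = Fin.rev k ↔ Fin.rev i = k := fun k => by
    constructor
    · rintro rfl; simp
    · rintro rfl; simp
  simp [Matrix.mul_apply, aux_flip, this]

noncomputable def auxW (m : ℕ) (ε : ℝ) : Matrix (Fin (m + m)) (Fin m) ℝ :=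
  Matrix.of fun i j => Fin.addCases (fun i => (1 : Matrix (Fin m) (Fin m) ℝ) i j)
    (fun i => ε * flipMat m i j) i

theorem auxW_left (m : ℕ) (ε : ℝ) (i j : Fin m) :
    auxW m ε (Fin.castAdd m i) j = (1 : Matrix (Fin m) (Fin m) ℝ) i j := by simp [auxW]

theorem auxW_right (m : ℕ) (ε : ℝ) (i j : Fin m) :
    auxW m ε (Fin.natAdd m i) j = ε * flipMat m i j := by simp [auxW, -Fin.natAdd_eq_addNat]

theorem aux_mulW {m : ℕ} (ε : ℝ) {α : Type*} (X : Matrix α (Fin (m + m)) ℝ) (i : α) (j : Fin m) :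
    (X * auxW m ε) i j = X i (Fin.castAdd m j) + ε * X i (Fin.natAdd m (Fin.rev j)) := by
  simp [-Fin.natAdd_eq_addNat, Matrix.mul_apply, Fin.sum_univ_add, auxW_left, auxW_right, Matrix.one_apply, aux_flip]
  ring

theorem auxW_mul_left {m : ℕ} (ε : ℝ) {α : Type*} (X : Matrix (Fin m) α ℝ) (i : Fin m) (j : α) :
    (auxW m ε * X) (Fin.castAdd m i) j = X i j := by
  simp [Matrix.mul_apply, auxW_left, Matrix.one_apply]

theorem auxW_mul_right {m : ℕ} (ε : ℝ) {α : Type*} (X : Matrix (Fin m) α ℝ) (i : Fin m) (j : α) :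
    (auxW m ε * X) (Fin.natAdd m i) j = ε * X (Fin.rev i) j := by
  rw [← aux_flip_mul X i j]
  simp [-Fin.natAdd_eq_addNat, Matrix.mul_apply, auxW_right, Finset.mul_sum, mul_assoc]

theorem aux_rev {m : ℕ} (v : Fin (m + m) → ℝ) (hv : ∀ l, v (-l) = v l) (a b : Fin (m + m)) :
    Matrix.circulant v (Fin.rev a) (Fin.rev b) = Matrix.circulant v a b := by
  rw [Matrix.circulant_apply, Matrix.circulant_apply, ← hv (a - b)]
  congr 1
  have : NeZero (m + m) := ⟨by have := a.2; omega⟩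
  have hrev : ∀ x : Fin (m + m), Fin.rev x = -1 - x := by
    intro x
    rw [eq_sub_iff_add_eq, eq_neg_iff_add_eq_zero]
    ext
    have := x.2
    simp only [Fin.val_add, Fin.val_rev, Fin.val_zero, Nat.mod_add_mod, Fin.val_one', Nat.add_mod_mod]
    rw [show m + m - (↑x + 1) + ↑x + 1 = m + m by omega, Nat.mod_self]
  rw [neg_sub, hrev, hrev]; abel

theorem aux_VW {m : ℕ} (ε : ℝ) (hε : ε * ε = 1) (V : Matrix (Fin (m + m)) (Fin (m + m)) ℝ)
    (hr : ∀ a b, V (Fin.rev a) (Fin.rev b) = V a b) (M : Matrix (Fin m) (Fin m) ℝ)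
    (hM : ∀ i j, M i j = V (Fin.castAdd m i) (Fin.castAdd m j)
      + ε * V (Fin.castAdd m i) (Fin.natAdd m (Fin.rev j))) :
    V * auxW m ε = auxW m ε * M := by
  ext i j
  rw [aux_mulW]
  refine Fin.addCases (fun i => ?_) (fun i => ?_) i
  · rw [auxW_mul_left, hM]
  · rw [auxW_mul_right, hM]
    have e1 := hr (Fin.natAdd m i) (Fin.castAdd m j)
    have e2 := hr (Fin.natAdd m i) (Fin.natAdd m (Fin.rev j))
    have c1 : ∀ k : Fin m, Fin.rev (Fin.castAdd m k) = Fin.natAdd m (Fin.rev k) := fun k => by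
      ext; simp only [Fin.val_rev, Fin.val_castAdd, Fin.val_natAdd]; omega
    have c2 : ∀ k : Fin m, Fin.rev (Fin.natAdd m k) = Fin.castAdd m (Fin.rev k) := fun k => by
      ext; simp only [Fin.val_rev, Fin.val_castAdd, Fin.val_natAdd]; omega
    rw [c1, c2] at e1
    rw [c2, c2, Fin.rev_rev] at e2
    rw [← e1, ← e2, mul_add, ← mul_assoc, hε, one_mul, add_comm]

theorem aux_pd {m : ℕ} (ε : ℝ) (hε : ε * ε = 1) (V : Matrix (Fin (m + m)) (Fin (m + m)) ℝ)
    (hV : V.PosDef) (M : Matrix (Fin m) (Fin m) ℝ) (h : V * auxW m ε = auxW m ε * M) :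
    M.PosDef := by
  have hinj : Function.Injective (auxW m ε).mulVec := by
    intro x y hxy
    ext i
    have := congrFun hxy (Fin.castAdd m i)
    simpa [Matrix.mulVec, dotProduct, auxW_left, Matrix.one_apply] using this
  have h1 := hV.conjTranspose_mul_mul_same hinj
  have hWW : (auxW m ε)ᴴ * auxW m ε = (2 : ℝ) • (1 : Matrix (Fin m) (Fin m) ℝ) := by
    ext i j
    rw [aux_mulW]
    simp only [Matrix.conjTranspose_apply, auxW_left, auxW_right, aux_flip, Matrix.smul_apply,
      Matrix.one_apply, star_trivial, Fin.rev_inj]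
    by_cases hij : i = j
    · subst hij; simp [hε]; try norm_num
    · simp [hij, Ne.symm hij, eq_comm]
  rw [Matrix.mul_assoc, h, ← Matrix.mul_assoc, hWW, Matrix.smul_mul, Matrix.one_mul] at h1
  have h2 := h1.smul (show (0 : ℝ) < 1 / 2 by norm_num)
  rwa [smul_smul, show (1 / 2 * 2 : ℝ) = 1 by norm_num, one_smul] at h2

theorem aux_PW (m : ℕ) (ε : ℝ) :
    Matrix.diagonal (fun i : Fin (m + m) => if (i : ℕ) < m then (1 : ℝ) else -1) * auxW m ε
      = auxW m (-ε) := by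
  ext i j
  rw [Matrix.diagonal_mul]
  refine Fin.addCases (fun i => ?_) (fun i => ?_) i
  · simp [auxW_left]
  · simp [-Fin.natAdd_eq_addNat, auxW_right]

theorem aux_Q {m : ℕ} (ε : ℝ) (V P : Matrix (Fin (m + m)) (Fin (m + m)) ℝ)
    (M N : Matrix (Fin m) (Fin m) ℝ) (hV : V.PosDef) (hM : M.PosDef) (hN : N.PosDef)
    (h1 : V * auxW m ε = auxW m ε * M) (h2 : V * auxW m (-ε) = auxW m (-ε) * N)
    (hP : P = Matrix.diagonal (fun i : Fin (m + m) => if (i : ℕ) < m then (1 : ℝ) else -1))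
    (p : ℝ) :
    mpow V (-p) * P * mpow V p * P * auxW m ε = auxW m ε * (mpow M (-p) * mpow N p) := by
  have a1 : mpow V (-p) * auxW m ε = auxW m ε * mpow M (-p) :=
    aux_intertwine V M _ hV.1 hM.1 h1 _
  have a2 : mpow V p * auxW m (-ε) = auxW m (-ε) * mpow N p :=
    aux_intertwine V N _ hV.1 hN.1 h2 _
  have b1 : P * auxW m ε = auxW m (-ε) := by rw [hP, aux_PW]
  have b2 : P * auxW m (-ε) = auxW m ε := by rw [hP, aux_PW, neg_neg]
  rw [Matrix.mul_assoc _ P, b1, Matrix.mul_assoc _ (mpow V p), a2, Matrix.mul_assoc _ P,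
    ← Matrix.mul_assoc P, b2, ← Matrix.mul_assoc, a1, Matrix.mul_assoc]

/-- For `V` circulant symmetric positive definite with blocks
`[[V', V''], [V'', V']]`, the matrices `V' ± V''F` are symmetric positive
definite, and the blocks of `Q = V^{-p} P V^{p} P` satisfy
`Q' + Q''F = (V'+V''F)^{-p}(V'-V''F)^{p}` and
`Q' - Q''F = (V'-V''F)^{-p}(V'+V''F)^{p}`. -/
theorem blocks_of_Q_as_power_products
    (m : ℕ) (hm : 0 < m)
    (v : Fin (m + m) → ℝ) (hv : ∀ l, v (-l) = v l)
    (V : Matrix (Fin (m + m)) (Fin (m + m)) ℝ) (hV : V = Matrix.circulant v)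
    (hVpd : V.PosDef)
    (V₁ V₂ : Matrix (Fin m) (Fin m) ℝ)
    (hV₁ : ∀ i j, V₁ i j = V (Fin.castAdd m i) (Fin.castAdd m j))
    (hV₂ : ∀ i j, V₂ i j = V (Fin.castAdd m i) (Fin.natAdd m j))
    (p : ℝ)
    (P : Matrix (Fin (m + m)) (Fin (m + m)) ℝ)
    (hP : P = Matrix.diagonal (fun i : Fin (m + m) => if (i : ℕ) < m then (1 : ℝ) else -1))
    (Q : Matrix (Fin (m + m)) (Fin (m + m)) ℝ)
    (hQ : Q = mpow V (-p) * P * mpow V p * P)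
    (Q₁ Q₂ : Matrix (Fin m) (Fin m) ℝ)
    (hQ₁ : ∀ i j, Q₁ i j = Q (Fin.castAdd m i) (Fin.castAdd m j))
    (hQ₂ : ∀ i j, Q₂ i j = Q (Fin.castAdd m i) (Fin.natAdd m j)) :
    (V₁ + V₂ * flipMat m).PosDef
      ∧ (V₁ - V₂ * flipMat m).PosDef
      ∧ Q₁ + Q₂ * flipMat m
          = mpow (V₁ + V₂ * flipMat m) (-p) * mpow (V₁ - V₂ * flipMat m) p
      ∧ Q₁ - Q₂ * flipMat m
          = mpow (V₁ - V₂ * flipMat m) (-p) * mpow (V₁ + V₂ * flipMat m) p := by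
  have hr : ∀ a b, V (Fin.rev a) (Fin.rev b) = V a b := by
    intro a b; rw [hV]; exact aux_rev v hv a b
  have h1 : V * auxW m 1 = auxW m 1 * (V₁ + V₂ * flipMat m) :=
    aux_VW 1 (by norm_num) V hr _ (fun i j => by
      rw [Matrix.add_apply, aux_mul_flip, hV₁, hV₂, one_mul])
  have h2 : V * auxW m (-1) = auxW m (-1) * (V₁ - V₂ * flipMat m) :=
    aux_VW (-1) (by norm_num) V hr _ (fun i j => by
      rw [Matrix.sub_apply, aux_mul_flip, hV₁, hV₂]; ring)
  have p1 := aux_pd 1 (by norm_num) V hVpd _ h1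
  have p2 := aux_pd (-1) (by norm_num) V hVpd _ h2
  have q1 := aux_Q 1 V P _ _ hVpd p1 p2 h1 h2 hP p
  have q2 := aux_Q (-1) V P _ _ hVpd p2 p1 h2 (by rw [neg_neg]; exact h1) hP p
  rw [← hQ] at q1 q2
  refine ⟨p1, p2, ?_, ?_⟩
  · ext i j
    have := congrFun (congrFun q1 (Fin.castAdd m i)) j
    rw [aux_mulW, auxW_mul_left] at this
    rw [← this, Matrix.add_apply, aux_mul_flip, hQ₁, hQ₂, one_mul]
  · ext i j
    have := congrFun (congrFun q2 (Fin.castAdd m i)) j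
    rw [aux_mulW, auxW_mul_left] at this
    rw [← this, Matrix.sub_apply, aux_mul_flip, hQ₁, hQ₂]; ring
end

section
/- Let n be an even positive integer, V a real n×n circulant symmetric positive definite matrix, p a real number, P = I_{n/2} ⊕ (−I_{n/2}), and Q = V^{−p} P V^{p} P with block form Q = [[Q', Q''], [Q'', Q']], F = F_{n/2}. Then det(Q' + Q''F) = exp(−p · Tr(F_n log V)) and det(Q' − Q''F) = exp(+p · Tr(F_n log V)), where log V is the matrix logarithm of V defined by the spectral calculus. -/
open Matrix

/-- Matrix logarithm defined via the continuous functional calculus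
(spectral calculus). -/
noncomputable def mlog {k : ℕ} (M : Matrix (Fin k) (Fin k) ℝ) :
    Matrix (Fin k) (Fin k) ℝ :=
  cfc Real.log M

/-- The intertwiner `[I; εF]`. -/
noncomputable def Kmat (m : ℕ) (ε : ℝ) : Matrix (Fin (m + m)) (Fin m) ℝ :=
  Matrix.of fun i j => Fin.addCases (fun i => (1 : Matrix (Fin m) (Fin m) ℝ) i j)
    (fun i => ε * flipMat m i j) i

lemma flipMat_apply' (m : ℕ) (i j : Fin m) : flipMat m i j = if j = Fin.rev i then 1 else 0 := by
  unfold flipMat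
  simp only [Matrix.of_apply, Fin.ext_iff, Fin.val_rev]
  have := i.2
  have := j.2
  congr 1
  simp only [eq_iff_iff]
  omega

lemma flipMat_apply2 (m : ℕ) (i j : Fin m) : flipMat m i j = if i = Fin.rev j then 1 else 0 := by
  rw [flipMat_apply']
  congr 1
  simp only [eq_iff_iff]
  exact ⟨fun h => by rw [h, Fin.rev_rev], fun h => by rw [h, Fin.rev_rev]⟩

lemma Kmat_top (m : ℕ) (ε : ℝ) (i j : Fin m) :
    Kmat m ε (Fin.castAdd m i) j = if i = j then 1 else 0 := by
  simp [-Fin.natAdd_eq_addNat, Kmat, Matrix.one_apply]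

lemma Kmat_bot (m : ℕ) (ε : ℝ) (i j : Fin m) :
    Kmat m ε (Fin.natAdd m i) j = ε * if i = Fin.rev j then 1 else 0 := by
  simp [-Fin.natAdd_eq_addNat, Kmat, flipMat_apply2]

lemma Kmat_tmul (m : ℕ) (ε : ℝ) (hε : ε * ε = 1) :
    (Kmat m ε)ᵀ * Kmat m ε = (2 : ℝ) • (1 : Matrix (Fin m) (Fin m) ℝ) := by
  ext i j
  rw [Matrix.mul_apply, Fin.sum_univ_add]
  simp only [Matrix.transpose_apply, Kmat_top, Kmat_bot, Matrix.smul_apply, Matrix.one_apply]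
  have : ∀ x : Fin m, (ε * if x = Fin.rev i then (1:ℝ) else 0) * (ε * if x = Fin.rev j then 1 else 0)
      = if x = Fin.rev i then (if x = Fin.rev j then 1 else 0) else 0 := by
    intro x; split_ifs <;> simp [hε]
  simp only [this]
  by_cases h : i = j
  · simp [h]; norm_num
  · simp [h, Ne.symm h]

lemma Kmat_mult (m : ℕ) (ε : ℝ) (hε : ε * ε = 1) :
    Kmat m ε * (Kmat m ε)ᵀ = 1 + ε • flipMat (m + m) := by
  ext i j
  rw [Matrix.mul_apply]
  simp only [Matrix.transpose_apply, Matrix.add_apply, Matrix.smul_apply, Matrix.one_apply, flipMat, Matrix.of_apply, smul_eq_mul]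
  induction i using Fin.addCases with
  | left i =>
    have := i.2
    induction j using Fin.addCases with
    | left j =>
      have := j.2
      have h : ¬ ((i:ℕ) + j = m + m - 1) := by omega
      simp [-Fin.natAdd_eq_addNat, Kmat_top, h]
    | right j =>
      have := j.2
      have h : (Fin.castAdd m i ≠ Fin.natAdd m j) := by
        simp only [ne_eq, Fin.ext_iff, Fin.val_castAdd, Fin.val_natAdd]; omega
      simp only [Kmat_top, Kmat_bot, ite_mul, one_mul, zero_mul, Finset.sum_ite_eq,
        Finset.mem_univ, if_true, h, if_false, zero_add, Fin.val_castAdd, Fin.val_natAdd]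
      congr 2
      simp only [eq_iff_iff, Fin.ext_iff, Fin.val_rev]
      omega
  | right i =>
    have := i.2
    induction j using Fin.addCases with
    | left j =>
      have := j.2
      have h : (Fin.natAdd m i ≠ Fin.castAdd m j) := by
        simp only [ne_eq, Fin.ext_iff, Fin.val_castAdd, Fin.val_natAdd]; omega
      simp [-Fin.natAdd_eq_addNat, Kmat_top, Kmat_bot, h]
      congr 1
      simp only [eq_iff_iff, Fin.ext_iff, Fin.val_rev]
      omega
    | right j =>
      have := j.2
      have h : ¬ (m + (i:ℕ) + (m + j) = m + m - 1) := by omega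
      have h2 : ∀ x : Fin m, (ε * if i = Fin.rev x then (1:ℝ) else 0) * (ε * if j = Fin.rev x then 1 else 0)
          = if Fin.rev i = x then (if j = Fin.rev x then 1 else 0) else 0 := by
        intro x
        have e : (i = Fin.rev x) ↔ (Fin.rev i = x) :=
          ⟨fun h => by rw [h, Fin.rev_rev], fun h => by rw [← h, Fin.rev_rev]⟩
        simp only [e]
        split_ifs <;> simp [hε]
      simp only [Kmat_bot, h2, Fin.val_natAdd, h]
      simp [-Fin.natAdd_eq_addNat]
      congr 1
      simp only [eq_iff_iff]; exact eq_comm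

lemma P_mul_Kmat (m : ℕ) (ε : ℝ) :
    Matrix.diagonal (fun i : Fin (m + m) => if (i : ℕ) < m then (1 : ℝ) else -1) * Kmat m ε
      = Kmat m (-ε) := by
  ext i j
  rw [Matrix.diagonal_mul]
  induction i using Fin.addCases with
  | left i => simp [-Fin.natAdd_eq_addNat, Kmat_top]
  | right i => simp [-Fin.natAdd_eq_addNat, Kmat_bot]

lemma mul_Kmat_top (m : ℕ) (ε : ℝ) (Q : Matrix (Fin (m + m)) (Fin (m + m)) ℝ) (i j : Fin m) :
    (Q * Kmat m ε) (Fin.castAdd m i) j = Q (Fin.castAdd m i) (Fin.castAdd m j)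
      + ε * ∑ l, Q (Fin.castAdd m i) (Fin.natAdd m l) * flipMat m l j := by
  rw [Matrix.mul_apply, Fin.sum_univ_add]
  simp [-Fin.natAdd_eq_addNat, Kmat_top, Kmat_bot, flipMat_apply2, mul_comm]

lemma flip_comm (m : ℕ) (hm : 0 < m) (v : Fin (m + m) → ℝ) (hv : ∀ l, v (-l) = v l) :
    Commute (Matrix.circulant v) (flipMat (m + m)) := by
  have : NeZero (m + m) := ⟨by omega⟩
  ext i j
  rw [Matrix.mul_apply, Matrix.mul_apply]
  simp_rw [flipMat_apply2 _ _ j, flipMat_apply' _ i]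
  simp only [mul_ite, ite_mul, mul_one, one_mul, mul_zero, zero_mul, Finset.sum_ite_eq',
    Finset.mem_univ, if_true, Matrix.circulant_apply]
  have key : ∀ a : Fin (m + m), Fin.rev a = -1 - a := by
    obtain ⟨k, hk⟩ : ∃ k, m + m = k + 1 := ⟨m + m - 1, by omega⟩
    generalize m + m = n at *
    subst hk
    intro a
    rw [← Fin.last_sub]
    congr 1
    exact Fin.ext (by rw [Fin.coe_neg_one, Fin.val_last])
  rw [key, key, ← hv]
  congr 1
  abel

lemma cfc_intertwine {a b : ℕ} (V : Matrix (Fin a) (Fin a) ℝ) (M : Matrix (Fin b) (Fin b) ℝ)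
    (hV : V.IsHermitian) (hM : M.IsHermitian) (K : Matrix (Fin a) (Fin b) ℝ)
    (h : V * K = K * M) (f : ℝ → ℝ) : cfc f V * K = K * cfc f M := by
  have hpow : ∀ k : ℕ, V ^ k * K = K * M ^ k := by
    intro k
    induction k with
    | zero => simp
    | succ k ih => rw [pow_succ, pow_succ, Matrix.mul_assoc, h, ← Matrix.mul_assoc, ih, Matrix.mul_assoc]
  have hpoly : ∀ q : Polynomial ℝ, Polynomial.aeval V q * K = K * Polynomial.aeval M q := by
    intro q
    induction q using Polynomial.induction_on' with
    | add p q hp hq => simp only [map_add, Matrix.add_mul, Matrix.mul_add, hp, hq]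
    | monomial n c =>
      simp only [Polynomial.aeval_monomial, ← Algebra.smul_def, Matrix.smul_mul, Matrix.mul_smul, hpow]
  have hfin : (spectrum ℝ V ∪ spectrum ℝ M).Finite :=
    (Matrix.finite_real_spectrum).union (Matrix.finite_real_spectrum)
  obtain ⟨q, hq⟩ : ∃ q : Polynomial ℝ, ∀ x ∈ spectrum ℝ V ∪ spectrum ℝ M, q.eval x = f x := by
    refine ⟨Lagrange.interpolate hfin.toFinset id f, fun x hx => ?_⟩
    exact Lagrange.eval_interpolate_at_node f (Function.injective_id.injOn) (hfin.mem_toFinset.2 hx)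
  have e1 : cfc f V = Polynomial.aeval V q := by
    rw [← cfc_polynomial q V hV.isSelfAdjoint]
    exact cfc_congr fun x hx => (hq x (Or.inl hx)).symm
  have e2 : cfc f M = Polynomial.aeval M q := by
    rw [← cfc_polynomial q M hM.isSelfAdjoint]
    exact cfc_congr fun x hx => (hq x (Or.inr hx)).symm
  rw [e1, e2, hpoly]

lemma det_mpow {b : ℕ} (M : Matrix (Fin b) (Fin b) ℝ) (hM : M.PosDef) (p : ℝ) :
    (mpow M p).det = Real.exp (p * (mlog M).trace) := by
  have hH := hM.1
  have hdet : ∀ f : ℝ → ℝ, (cfc f M).det = ∏ i, f (hH.eigenvalues i) := by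
    intro f
    rw [hH.cfc_eq, Matrix.IsHermitian.cfc]
    have hU : (hH.eigenvectorUnitary : Matrix (Fin b) (Fin b) ℝ).det
        * (star (hH.eigenvectorUnitary : Matrix (Fin b) (Fin b) ℝ)).det = 1 := by
      rw [← Matrix.det_mul, Unitary.mul_star_self_of_mem hH.eigenvectorUnitary.2, Matrix.det_one]
    rw [Unitary.conjStarAlgAut_apply, Matrix.det_mul, Matrix.det_mul, mul_right_comm, hU,
      one_mul, Matrix.det_diagonal]
    simp
  have htr : ∀ f : ℝ → ℝ, (cfc f M).trace = ∑ i, f (hH.eigenvalues i) := by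
    intro f
    rw [hH.cfc_eq, Matrix.IsHermitian.cfc, Unitary.conjStarAlgAut_apply, Matrix.trace_mul_cycle]
    simp
  rw [mpow, mlog, hdet, htr, Finset.mul_sum, Real.exp_sum]
  refine Finset.prod_congr rfl fun i _ => ?_
  rw [Real.rpow_def_of_pos (hM.eigenvalues_pos i), mul_comm]

/-- compressed matrix -/
noncomputable def phi (m : ℕ) (ε : ℝ) (W : Matrix (Fin (m + m)) (Fin (m + m)) ℝ) :
    Matrix (Fin m) (Fin m) ℝ := (1/2 : ℝ) • ((Kmat m ε)ᵀ * W * Kmat m ε)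

lemma phi_spec (m : ℕ) (ε : ℝ) (hε : ε * ε = 1) (V : Matrix (Fin (m + m)) (Fin (m + m)) ℝ)
    (hc : Commute V (flipMat (m + m))) : V * Kmat m ε = Kmat m ε * phi m ε V := by
  have hc' : V * (Kmat m ε * (Kmat m ε)ᵀ) = (Kmat m ε * (Kmat m ε)ᵀ) * V := by
    rw [Kmat_mult m ε hε, Matrix.mul_add, Matrix.add_mul, Matrix.mul_smul, Matrix.smul_mul, hc.eq]
    simp
  rw [phi, Matrix.mul_smul, ← Matrix.mul_assoc, ← Matrix.mul_assoc, ← hc', Matrix.mul_assoc,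
    Matrix.mul_assoc, Kmat_tmul m ε hε]
  simp

lemma Kmat_cancel (m : ℕ) (ε : ℝ) (hε : ε * ε = 1) (A B : Matrix (Fin m) (Fin m) ℝ)
    (h : Kmat m ε * A = Kmat m ε * B) : A = B := by
  have := congrArg (fun X => (1/2 : ℝ) • ((Kmat m ε)ᵀ * X)) h
  simpa [← Matrix.mul_assoc, Kmat_tmul m ε hε, smul_smul] using this

lemma phi_posDef (m : ℕ) (ε : ℝ) (hε : ε * ε = 1) (V : Matrix (Fin (m + m)) (Fin (m + m)) ℝ)
    (hV : V.PosDef) : (phi m ε V).PosDef := by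
  have hinj : Function.Injective (Kmat m ε).mulVec := by
    intro x y h
    have := congrArg (fun X => (1/2 : ℝ) • ((Kmat m ε)ᵀ *ᵥ X)) h
    simpa [Matrix.mulVec_mulVec, Kmat_tmul m ε hε, smul_smul, Matrix.smul_mulVec] using this
  have := hV.conjTranspose_mul_mul_same hinj
  rw [Matrix.conjTranspose_eq_transpose_of_trivial] at this
  exact this.smul (by norm_num)

lemma cfc_phi (m : ℕ) (ε : ℝ) (hε : ε * ε = 1) (V : Matrix (Fin (m + m)) (Fin (m + m)) ℝ)
    (hV : V.PosDef) (hc : Commute V (flipMat (m + m))) (f : ℝ → ℝ) :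
    cfc f V * Kmat m ε = Kmat m ε * cfc f (phi m ε V) :=
  cfc_intertwine V _ hV.1 (phi_posDef m ε hε V hV).1 _ (phi_spec m ε hε V hc) f

lemma trace_cfc_phi (m : ℕ) (ε : ℝ) (hε : ε * ε = 1) (V : Matrix (Fin (m + m)) (Fin (m + m)) ℝ)
    (hV : V.PosDef) (hc : Commute V (flipMat (m + m))) (f : ℝ → ℝ) :
    2 * (cfc f (phi m ε V)).trace
      = (cfc f V).trace + ε * (flipMat (m + m) * cfc f V).trace := by
  have h := congrArg (fun X => ((Kmat m ε)ᵀ * X).trace) (cfc_phi m ε hε V hV hc f)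
  rw [← Matrix.mul_assoc _ (Kmat m ε), Kmat_tmul m ε hε, Matrix.trace_mul_comm, Matrix.mul_assoc,
    Kmat_mult m ε hε, Matrix.trace_mul_comm, Matrix.add_mul, Matrix.trace_add] at h
  simpa using h.symm

lemma main_aux (m : ℕ) (ε : ℝ) (hε : ε * ε = 1) (V : Matrix (Fin (m + m)) (Fin (m + m)) ℝ)
    (hV : V.PosDef) (hc : Commute V (flipMat (m + m))) (p : ℝ)
    (P : Matrix (Fin (m + m)) (Fin (m + m)) ℝ)
    (hP : P = Matrix.diagonal (fun i : Fin (m + m) => if (i : ℕ) < m then (1 : ℝ) else -1))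
    (R : Matrix (Fin m) (Fin m) ℝ)
    (hR : ∀ i j, R i j = (mpow V (-p) * P * mpow V p * P * Kmat m ε) (Fin.castAdd m i) j) :
    R.det = Real.exp (-p * ε * (flipMat (m + m) * mlog V).trace) := by
  have hε' : -ε * -ε = 1 := by rw [neg_mul_neg, hε]
  have hprod : mpow V (-p) * P * mpow V p * P * Kmat m ε
      = Kmat m ε * (mpow (phi m ε V) (-p) * mpow (phi m (-ε) V) p) := by
    have a1 : P * Kmat m ε = Kmat m (-ε) := by rw [hP, P_mul_Kmat]
    have a2 : P * Kmat m (-ε) = Kmat m ε := by rw [hP, P_mul_Kmat, neg_neg]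
    have a3 : mpow V p * Kmat m (-ε) = Kmat m (-ε) * mpow (phi m (-ε) V) p :=
      cfc_phi m (-ε) hε' V hV hc _
    have a4 : mpow V (-p) * Kmat m ε = Kmat m ε * mpow (phi m ε V) (-p) :=
      cfc_phi m ε hε V hV hc _
    rw [Matrix.mul_assoc _ P, a1, Matrix.mul_assoc _ (mpow V p), a3, Matrix.mul_assoc _ P,
      ← Matrix.mul_assoc P, a2, ← Matrix.mul_assoc, a4, Matrix.mul_assoc]
  have hR' : R = mpow (phi m ε V) (-p) * mpow (phi m (-ε) V) p := by
    ext i j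
    rw [hR, hprod, Matrix.mul_apply]
    simp [-Fin.natAdd_eq_addNat, Kmat_top]
  rw [hR', Matrix.det_mul, det_mpow _ (phi_posDef m ε hε V hV),
    det_mpow _ (phi_posDef m (-ε) hε' V hV), ← Real.exp_add]
  congr 1
  have t1 := trace_cfc_phi m ε hε V hV hc Real.log
  have t2 := trace_cfc_phi m (-ε) hε' V hV hc Real.log
  unfold mlog
  linear_combination (-p / 2) * t1 + (p / 2) * t2

/-- For `V` circulant symmetric positive definite and
`Q = V^{-p} P V^{p} P` with blocks `[[Q', Q''], [Q'', Q']]`,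
`det(Q' + Q''F) = exp(-p Tr(F_n log V))` and
`det(Q' - Q''F) = exp(+p Tr(F_n log V))`. -/
theorem det_of_Q_blocks
    (m : ℕ) (hm : 0 < m)
    (v : Fin (m + m) → ℝ) (hv : ∀ l, v (-l) = v l)
    (V : Matrix (Fin (m + m)) (Fin (m + m)) ℝ) (hV : V = Matrix.circulant v)
    (hVpd : V.PosDef)
    (p : ℝ)
    (P : Matrix (Fin (m + m)) (Fin (m + m)) ℝ)
    (hP : P = Matrix.diagonal (fun i : Fin (m + m) => if (i : ℕ) < m then (1 : ℝ) else -1))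
    (Q : Matrix (Fin (m + m)) (Fin (m + m)) ℝ)
    (hQ : Q = mpow V (-p) * P * mpow V p * P)
    (Q₁ Q₂ : Matrix (Fin m) (Fin m) ℝ)
    (hQ₁ : ∀ i j, Q₁ i j = Q (Fin.castAdd m i) (Fin.castAdd m j))
    (hQ₂ : ∀ i j, Q₂ i j = Q (Fin.castAdd m i) (Fin.natAdd m j)) :
    (Q₁ + Q₂ * flipMat m).det
        = Real.exp (-p * (flipMat (m + m) * mlog V).trace)
      ∧ (Q₁ - Q₂ * flipMat m).det
        = Real.exp (p * (flipMat (m + m) * mlog V).trace) := by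
  have hc : Commute V (flipMat (m + m)) := hV ▸ flip_comm m hm v hv
  constructor
  · rw [main_aux m 1 (by norm_num) V hVpd hc p P hP]
    · simp
    · intro i j
      rw [← hQ, mul_Kmat_top]
      simp [Matrix.mul_apply, hQ₁, hQ₂]
  · rw [main_aux m (-1) (by norm_num) V hVpd hc p P hP]
    · simp
    · intro i j
      rw [← hQ, mul_Kmat_top]
      simp [Matrix.mul_apply, hQ₁, hQ₂, sub_eq_add_neg]
end

section
/- Let n be an even positive integer and V a real n×n circulant symmetric positive definite matrix with eigenvalues Λ_k = ∑_{l=0}^{n−1} v_l e^{2πikl/n}. Let P = diag((−1)^k)_{k=0}^{n−1}, Q = V^{−1/2} P V^{1/2} P, and let λ_1,…,λ_n be the (real, positive) eigenvalues of Q. Then the logarithmic negativity between the even-indexed and odd-indexed oscillators, N = −∑_{j=1}^{n} log₂ min(1, λ_j), equals N = (1/2) ∑_{k=0}^{n/2−1} |log₂(Λ_k / Λ_{k+n/2})|. -/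
open Matrix Polynomial

lemma ln_aeval {n : ℕ} (A : Matrix (Fin n) (Fin n) ℝ) (x : Fin n → ℂ) (a : ℝ)
    (h : A.map Complex.ofRealHom *ᵥ x = (a : ℂ) • x) (q : ℝ[X]) :
    (aeval A q).map Complex.ofRealHom *ᵥ x = ((q.eval a : ℝ) : ℂ) • x := by
  induction q using Polynomial.induction_on' with
  | add p q hp hq =>
    rw [map_add, Matrix.map_add _ (by simp), Matrix.add_mulVec, hp, hq]
    simp [add_smul]
  | monomial k c =>
    rw [aeval_monomial, eval_monomial]
    have hk : ∀ k : ℕ, (A ^ k).map Complex.ofRealHom *ᵥ x = ((a ^ k : ℝ) : ℂ) • x := by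
      intro k
      induction k with
      | zero => simp
      | succ k ih =>
        rw [pow_succ, Matrix.map_mul, ← Matrix.mulVec_mulVec, h, Matrix.mulVec_smul, ih, smul_smul]
        push_cast
        congr 1
        ring
    rw [Matrix.map_mul, ← Matrix.mulVec_mulVec, hk, Matrix.mulVec_smul]
    have : (algebraMap ℝ (Matrix (Fin n) (Fin n) ℝ) c).map Complex.ofRealHom *ᵥ x
        = (c : ℂ) • x := by
      rw [Matrix.algebraMap_eq_diagonal, Matrix.diagonal_map (by simp)]
      ext i
      simp [Matrix.mulVec_diagonal]
    rw [this, smul_smul]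
    push_cast
    congr 1
    ring

lemma ln_mpow {n : ℕ} (A : Matrix (Fin n) (Fin n) ℝ) (hA : A.IsHermitian)
    (x : Fin n → ℂ) (a : ℝ)
    (h : A.map Complex.ofRealHom *ᵥ x = (a : ℂ) • x) (p : ℝ) :
    (mpow A p).map Complex.ofRealHom *ᵥ x = ((a ^ p : ℝ) : ℂ) • x := by
  classical
  have hfin : (spectrum ℝ A).Finite := Matrix.finite_spectrum A
  let s : Finset ℝ := insert a hfin.toFinset
  let q : ℝ[X] := Lagrange.interpolate s id (fun x => x ^ p)
  have hq : ∀ y ∈ s, q.eval y = y ^ p := fun y hy =>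
    Lagrange.eval_interpolate_at_node (v := id) (fun x => x ^ p)
      (Function.injective_id.injOn) hy
  have e : mpow A p = aeval A q := by
    unfold mpow
    rw [← cfc_polynomial q A hA]
    apply cfc_congr
    intro y hy
    exact (hq y (by simp [s, hy])).symm
  rw [e, ln_aeval A x a h, hq a (by simp [s])]

lemma ln_pair (a b : ℝ) (ha : 0 < a) (hb : 0 < b) :
    -(Real.logb 2 (min 1 (a ^ (-(1/2) : ℝ) * b ^ (1/2 : ℝ))) +
      Real.logb 2 (min 1 (b ^ (-(1/2) : ℝ) * a ^ (1/2 : ℝ)))) =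
    (1 / 2) * |Real.logb 2 (a / b)| := by
  have key : ∀ a b : ℝ, 0 < a → 0 < b →
      Real.logb 2 (min 1 (a ^ (-(1/2) : ℝ) * b ^ (1/2 : ℝ))) =
      min 0 ((Real.logb 2 b - Real.logb 2 a) / 2) := by
    intro a b ha hb
    have hm : MonotoneOn (Real.logb 2) (Set.Ioi 0) :=
      (Real.strictMonoOn_logb (by norm_num)).monotoneOn
    have hp : 0 < a ^ (-(1/2) : ℝ) * b ^ (1/2 : ℝ) := by positivity
    rw [hm.map_min (by simp) hp, Real.logb_one, Real.logb_mul (by positivity) (by positivity),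
      Real.logb_rpow_eq_mul_logb_of_pos ha, Real.logb_rpow_eq_mul_logb_of_pos hb]
    congr 1
    ring
  rw [key a b ha hb, key b a hb ha, Real.logb_div ha.ne' hb.ne']
  rcases le_total (Real.logb 2 a) (Real.logb 2 b) with h | h
  · rw [min_eq_left (by linarith), min_eq_right (by linarith), abs_of_nonpos (by linarith)]
    ring
  · rw [min_eq_right (by linarith), min_eq_left (by linarith), abs_of_nonneg (by linarith)]
    ring

/-- For `n = m + m` even positive, `V` circulant symmetric
positive definite with Fourier eigenvalues `Λ_k`, `P = diag((-1)^k)`,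
`Q = V^{-1/2} P V^{1/2} P` with (real, positive) eigenvalues `λ₁, …, λₙ`
(encoded via the factorization of the characteristic polynomial), the
logarithmic negativity between even- and odd-indexed oscillators,
`N = -∑ⱼ log₂ min(1, λⱼ)`, equals `(1/2) ∑_{k<n/2} |log₂(Λ_k/Λ_{k+n/2})|`. -/
theorem logneg_even_odd_bisection
    (m : ℕ) (hm : 0 < m)
    (v : Fin (m + m) → ℝ) (hv : ∀ l, v (-l) = v l)
    (V : Matrix (Fin (m + m)) (Fin (m + m)) ℝ) (hV : V = Matrix.circulant v)
    (hVpd : V.PosDef)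
    (Λ : Fin (m + m) → ℝ)
    (hΛ : ∀ k : Fin (m + m), (Λ k : ℂ) =
      ∑ l : Fin (m + m), (v l : ℂ) *
        Complex.exp (2 * Real.pi * Complex.I * (k : ℕ) * (l : ℕ) / (m + m : ℕ)))
    (P : Matrix (Fin (m + m)) (Fin (m + m)) ℝ)
    (hP : P = Matrix.diagonal (fun k : Fin (m + m) => (-1 : ℝ) ^ (k : ℕ)))
    (Q : Matrix (Fin (m + m)) (Fin (m + m)) ℝ)
    (hQ : Q = mpow V (-(1/2)) * P * mpow V (1/2) * P)
    (lam : Fin (m + m) → ℝ)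
    (hlam : Q.charpoly = ∏ j : Fin (m + m), (X - C (lam j)))
    (N : ℝ) (hN : N = -∑ j : Fin (m + m), Real.logb 2 (min 1 (lam j))) :
    N = (1 / 2) * ∑ k : Fin m,
      |Real.logb 2 (Λ (Fin.castAdd m k) / Λ (Fin.natAdd m k))| := by
  classical
  have : NeZero (m + m) := ⟨by omega⟩
  set ω : ℂ := Complex.exp (2 * Real.pi * Complex.I / (m + m : ℕ)) with hω
  have hprim : IsPrimitiveRoot ω (m + m) := Complex.isPrimitiveRoot_exp _ (by omega)
  have hω1 : ω ^ (m + m) = 1 := hprim.pow_eq_one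
  have hωm : ω ^ m = -1 := by
    have h1 : (ω ^ m - 1) * (ω ^ m + 1) = 0 := by
      have : ω ^ m * ω ^ m = 1 := by rw [← pow_add, hω1]
      linear_combination this
    rcases mul_eq_zero.mp h1 with h | h
    · exact absurd (sub_eq_zero.mp h) (hprim.pow_ne_one_of_pos_of_lt (by omega) (by omega))
    · linear_combination h
  have hconj : ω * (starRingEnd ℂ) ω = 1 := by
    rw [Complex.mul_conj, Complex.normSq_eq_norm_sq, hprim.norm'_eq_one (by omega)]
    simp
  let F : Fin (m + m) → Fin (m + m) → ℂ := fun k j => (ω ^ (k : ℕ)) ^ (j : ℕ)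
  have hFe : ∀ k l : Fin (m + m),
      Complex.exp (2 * Real.pi * Complex.I * (k : ℕ) * (l : ℕ) / (m + m : ℕ)) = F k l := by
    intro k l
    simp only [F, hω]
    rw [← Complex.exp_nat_mul, ← Complex.exp_nat_mul]
    congr 1
    ring
  have hFc : ∀ k l, F k l * (starRingEnd ℂ) (F k l) = 1 := by
    intro k l
    simp only [F, map_pow]
    rw [← mul_pow, ← mul_pow, hconj]
    simp
  have hFadd : ∀ k i j : Fin (m + m), F k (i + j) = F k i * F k j := by
    intro k i j
    have h1 : (ω ^ (k : ℕ)) ^ (m + m) = 1 := by rw [pow_right_comm, hω1, one_pow]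
    simp only [F]
    rw [← pow_add, Fin.val_add, ← pow_eq_pow_mod _ h1]
  have hVF : ∀ k, V.map Complex.ofRealHom *ᵥ F k = (Λ k : ℂ) • F k := by
    intro k
    have hΛ2 : (Λ k : ℂ) = ∑ l, (v l : ℂ) * (starRingEnd ℂ) (F k l) := by
      have := congrArg (starRingEnd ℂ) (hΛ k)
      rw [Complex.conj_ofReal, map_sum] at this
      rw [this]
      refine Finset.sum_congr rfl fun l _ => ?_
      rw [map_mul, Complex.conj_ofReal, hFe]
    ext j
    rw [hΛ2]
    simp only [Matrix.mulVec, dotProduct, Matrix.map_apply, hV, Matrix.circulant_apply,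
      Pi.smul_apply, smul_eq_mul, Finset.sum_mul]
    rw [← Equiv.sum_comp (Equiv.subLeft j)]
    refine Finset.sum_congr rfl fun l _ => ?_
    have h2 : F k j = F k (j - l) * F k l := by rw [← hFadd, sub_add_cancel]
    simp only [Equiv.subLeft_apply, sub_sub_cancel]
    rw [h2]
    simp only [Complex.ofRealHom_eq_coe]
    linear_combination (-(v l : ℂ) * F k (j - l)) * hFc k l
  have hpos : ∀ k, 0 < Λ k := by
    intro k
    let u : Fin (m + m) → ℝ := fun j => (F k j).re
    have hu : V *ᵥ u = Λ k • u := by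
      ext j
      have := congrArg Complex.re (congrFun (hVF k) j)
      simpa [Matrix.mulVec, dotProduct, u] using this
    have hu0 : u ≠ 0 := by
      intro h
      have := congrFun h 0
      simp [u, F] at this
    have h1 := hVpd.dotProduct_mulVec_pos hu0
    rw [hu, dotProduct_smul, smul_eq_mul] at h1
    have h2 : 0 ≤ star u ⬝ᵥ u := by
      simp only [dotProduct, star_trivial]
      exact Finset.sum_nonneg fun i _ => mul_self_nonneg _
    exact pos_of_mul_pos_left h1 h2
  let σ : Fin (m + m) → Fin (m + m) := fun k => finAddFlip k
  have hσ1 : ∀ i : Fin m, σ (Fin.castAdd m i) = Fin.natAdd m i :=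
    fun i => finAddFlip_apply_castAdd i m
  have hσ2 : ∀ i : Fin m, σ (Fin.natAdd m i) = Fin.castAdd m i :=
    fun i => finAddFlip_apply_natAdd i m
  have hσσ : ∀ k, σ (σ k) = k := by
    intro k
    refine Fin.addCases (fun i => ?_) (fun i => ?_) k <;> simp only [hσ1, hσ2]
  have hωσ : ∀ k, ω ^ ((σ k : Fin (m + m)) : ℕ) = - ω ^ (k : ℕ) := by
    intro k
    refine Fin.addCases (fun i => ?_) (fun i => ?_) k <;>
      simp only [hσ1, hσ2, Fin.val_castAdd, Fin.val_natAdd, pow_add, hωm] <;> ring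
  have hPF : ∀ k, P.map Complex.ofRealHom *ᵥ F k = F (σ k) := by
    intro k
    rw [hP, Matrix.diagonal_map (by simp)]
    ext j
    rw [Matrix.mulVec_diagonal]
    simp only [F, hωσ]
    rw [neg_pow (ω ^ (k : ℕ))]
    simp
  let μ : Fin (m + m) → ℝ := fun k => (Λ k) ^ (-(1/2) : ℝ) * (Λ (σ k)) ^ (1/2 : ℝ)
  have hQF : ∀ k, Q.map Complex.ofRealHom *ᵥ F k = (μ k : ℂ) • F k := by
    intro k
    rw [hQ, Matrix.map_mul, Matrix.map_mul, Matrix.map_mul, ← Matrix.mulVec_mulVec, hPF,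
      ← Matrix.mulVec_mulVec, ln_mpow V hVpd.isHermitian _ _ (hVF _), Matrix.mulVec_smul,
      ← Matrix.mulVec_mulVec, hPF, hσσ, ln_mpow V hVpd.isHermitian _ _ (hVF _), smul_smul]
    simp only [μ]
    push_cast
    rw [mul_comm]
  let W : Matrix (Fin (m + m)) (Fin (m + m)) ℂ := (Matrix.of F)ᵀ
  have hW : IsUnit W := by
    rw [Matrix.isUnit_iff_isUnit_det, isUnit_iff_ne_zero, Matrix.det_transpose]
    have : Matrix.of F = Matrix.vandermonde (fun k : Fin (m + m) => ω ^ (k : ℕ)) := by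
      ext i j
      simp [F, Matrix.vandermonde_apply]
    rw [this, Matrix.det_vandermonde_ne_zero_iff]
    intro i j hij
    exact Fin.ext (hprim.pow_inj i.2 j.2 hij)
  have hQW : Q.map Complex.ofRealHom * W = W * Matrix.diagonal (fun k => (μ k : ℂ)) := by
    ext i k
    have := congrFun (hQF k) i
    rw [Matrix.mul_diagonal]
    simpa [Matrix.mul_apply, Matrix.mulVec, dotProduct, W, mul_comm] using this
  have hchar : (Q.map Complex.ofRealHom).charpoly = ∏ k, (X - C (μ k : ℂ)) := by
    obtain ⟨w, hw⟩ := hW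
    have : Q.map Complex.ofRealHom =
        w.val * Matrix.diagonal (fun k => (μ k : ℂ)) * w.val⁻¹ := by
      rw [← Matrix.coe_units_inv, hw, ← hQW, ← hw, mul_assoc, Units.mul_inv, mul_one]
    rw [this, Matrix.charpoly_units_conj, Matrix.charpoly_diagonal]
  have hQc : ∏ j, (X - C (lam j)) = ∏ k, (X - C (μ k)) := by
    apply Polynomial.map_injective Complex.ofRealHom Complex.ofReal_injective
    rw [← hlam, ← Matrix.charpoly_map, hchar, Polynomial.map_prod]
    simp
  have hms : Multiset.map lam Finset.univ.val = Multiset.map μ Finset.univ.val := by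
    have := congrArg Polynomial.roots hQc
    rw [Polynomial.roots_prod _ _ (Finset.prod_ne_zero_iff.mpr fun i _ => X_sub_C_ne_zero _),
      Polynomial.roots_prod _ _ (Finset.prod_ne_zero_iff.mpr fun i _ => X_sub_C_ne_zero _)] at this
    simpa [Multiset.bind_singleton] using this
  have hsum : ∑ j, Real.logb 2 (min 1 (lam j)) = ∑ j, Real.logb 2 (min 1 (μ j)) := by
    have := congrArg (fun s => (Multiset.map (fun x => Real.logb 2 (min 1 x)) s).sum) hms
    simpa only [Multiset.map_map, Function.comp_def, Finset.sum] using this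
  rw [hN, hsum, Fin.sum_univ_add, ← Finset.sum_add_distrib, ← Finset.sum_neg_distrib,
    Finset.mul_sum]
  refine Finset.sum_congr rfl fun k _ => ?_
  rw [← ln_pair _ _ (hpos _) (hpos _)]
  simp only [μ, hσ1, hσ2]
end
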